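/- With K, σ₁, σ₂ and the operators D̃₁, …, D̃₆ : K → K as in the context (type G₂ Demazure-type operators), the operator identity D̃₁∘D̃₃ + D̃₃∘D̃₅ − D̃₅∘D̃₁ − D̃₃ = 0 holds, i.e., for every f ∈ K, D̃₁(D̃₃(f)) + D̃₃(D̃₅(f)) − D̃₅(D̃₁(f)) − D̃₃(f) = 0. (Lemma 3.3(3).) -/

import Mathlib

noncomputable section

local notation "K" => FractionRing (MvPolynomial (Fin 2) ℤ)

noncomputable def t1 : FractionRing (MvPolynomial (Fin 2) ℤ) :=
  algebraMap (MvPolynomial (Fin 2) ℤ) _ (MvPolynomial.X 0)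

noncomputable def t2 : FractionRing (MvPolynomial (Fin 2) ℤ) :=
  algebraMap (MvPolynomial (Fin 2) ℤ) _ (MvPolynomial.X 1)

theorem ringHom_ext_of_t1_t2 {φ ψ : K →+* K} (h1 : φ t1 = ψ t1) (h2 : φ t2 = ψ t2) :
    φ = ψ := by
  apply IsLocalization.ringHom_ext (nonZeroDivisors (MvPolynomial (Fin 2) ℤ))
  apply MvPolynomial.ringHom_ext
  · intro n
    simp
  · intro i
    fin_cases i
    · exact h1
    · exact h2

theorem algebraMap_ne_zero_of_eval_ne_zero {p : MvPolynomial (Fin 2) ℤ}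
    (hp : MvPolynomial.eval 0 p ≠ 0) : algebraMap (MvPolynomial (Fin 2) ℤ) K p ≠ 0 := by
  rw [Ne, IsFractionRing.to_map_eq_zero_iff]
  rintro rfl
  simp at hp

theorem t1_ne_zero : t1 ≠ 0 := by
  rw [t1, Ne, IsFractionRing.to_map_eq_zero_iff]
  exact MvPolynomial.X_ne_zero 0

theorem t2_ne_zero : t2 ≠ 0 := by
  rw [t2, Ne, IsFractionRing.to_map_eq_zero_iff]
  exact MvPolynomial.X_ne_zero 1

theorem one_sub_t1_pow_mul_t2_pow_ne_zero {m n : ℕ} (h : m ≠ 0) :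
    1 - t1 ^ m * t2 ^ n ≠ 0 := by
  have := algebraMap_ne_zero_of_eval_ne_zero
    (p := 1 - MvPolynomial.X 0 ^ m * MvPolynomial.X 1 ^ n) (by simp [h])
  simpa [t1, t2] using this

theorem stmt_15 (σ1 σ2 : K ≃+* K)
    (h11 : σ1 t1 = t1⁻¹) (h12 : σ1 t2 = t1 ^ 3 * t2)
    (h21 : σ2 t1 = t1 * t2) (h22 : σ2 t2 = t2⁻¹)
    (D1 D2 : K → K)
    (hD1 : ∀ f, D1 f = (1 - t1)⁻¹ * (f - σ1 f))
    (hD2 : ∀ f, D2 f = (1 - t2)⁻¹ * (f - σ2 f))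
    (Dt1 Dt2 Dt3 Dt4 Dt5 Dt6 : K → K)
    (hDt1 : Dt1 = D1)
    (hDt2 : Dt2 = ⇑σ1 ∘ D2 ∘ ⇑σ1)
    (hDt3 : Dt3 = ⇑σ1 ∘ ⇑σ2 ∘ D1 ∘ ⇑σ2 ∘ ⇑σ1)
    (hDt4 : Dt4 = ⇑σ2 ∘ ⇑σ1 ∘ D2 ∘ ⇑σ1 ∘ ⇑σ2)
    (hDt5 : Dt5 = ⇑σ2 ∘ D1 ∘ ⇑σ2)
    (hDt6 : Dt6 = D2) :
    ∀ f : K, Dt1 (Dt3 f) + Dt3 (Dt5 f) - Dt5 (Dt1 f) - Dt3 f = 0 := by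
  have n1 := t1_ne_zero
  have n2 := t2_ne_zero
  have m1 : 1 - t1 ≠ 0 := by
    simpa using one_sub_t1_pow_mul_t2_pow_ne_zero (m := 1) (n := 0) one_ne_zero
  have m2 : 1 - t1 * t2 ≠ 0 := by
    simpa using one_sub_t1_pow_mul_t2_pow_ne_zero (m := 1) (n := 1) one_ne_zero
  have m3 : 1 - t1 ^ 2 * t2 ≠ 0 := by
    simpa using one_sub_t1_pow_mul_t2_pow_ne_zero (m := 2) (n := 1) two_ne_zero
  have s1 (f : K) : σ1 (σ1 f) = f := by
    have h : (σ1 : K →+* K).comp (σ1 : K →+* K) = RingHom.id _ := by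
      apply ringHom_ext_of_t1_t2
      · simp [h11]
      · simp [h11, h12]
        field_simp
    exact DFunLike.congr_fun h f
  have s2 (f : K) : σ2 (σ2 f) = f := by
    have h : (σ2 : K →+* K).comp (σ2 : K →+* K) = RingHom.id _ := by
      apply ringHom_ext_of_t1_t2
      · simp [h21, h22]
        field_simp
      · simp [h22]
    exact DFunLike.congr_fun h f
  have braid (f : K) : σ1 (σ2 (σ1 (σ2 (σ1 (σ2 (σ1 (σ2 f))))))) =
      σ2 (σ1 (σ2 (σ1 f))) := by
    have h : ((σ1 : K →+* K).comp (σ2 : K →+* K)).comp (((σ1 : K →+* K).comp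
        (σ2 : K →+* K)).comp (((σ1 : K →+* K).comp (σ2 : K →+* K)).comp
        ((σ1 : K →+* K).comp (σ2 : K →+* K)))) = ((σ2 : K →+* K).comp (σ1 : K →+* K)).comp
        ((σ2 : K →+* K).comp (σ1 : K →+* K)) := by
      apply ringHom_ext_of_t1_t2
      · simp [h11, h12, h21, h22]
        field_simp
      · simp [h11, h12, h21, h22]
        field_simp
    exact DFunLike.congr_fun h f
  have e5 (f : K) : Dt5 f = (1 - t1 * t2)⁻¹ * (f - σ2 (σ1 (σ2 f))) := by
    simp [hDt5, hD1, h21, s2]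
  have e3 (f : K) : Dt3 f =
      (1 - t1 ^ 2 * t2)⁻¹ * (f - σ1 (σ2 (σ1 (σ2 (σ1 f))))) := by
    have h : σ1 t1 * σ1 t2 = t1 ^ 2 * t2 := by
      rw [h11, h12]
      field_simp
    simp [hDt3, hD1, h21, h, s1, s2]
  have a1 : σ1 (t1 ^ 2 * t2) = t1 * t2 := by
    simp [h11, h12]
    field_simp
  have a3 : σ1 (σ2 (σ1 (σ2 (σ1 (t1 * t2))))) = t1⁻¹ := by
    simp [h11, h12, h21, h22]
    field_simp
  have a5 : σ2 (σ1 (σ2 t1)) = t1 ^ 2 * t2 := by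
    simp [h11, h12, h21, h22]
    field_simp
  intro f
  simp only [hDt1, hD1, e5, e3]
  simp only [map_mul σ1 (_⁻¹), map_mul σ2 (_⁻¹), map_inv₀, map_sub, map_one, a1, a3, a5,
    s1, braid]
  have inv : (1 - t1⁻¹)⁻¹ = 1 - (1 - t1)⁻¹ := by
    apply inv_eq_of_mul_eq_one_right
    field_simp
    ring
  rw [inv]
  field_simp
  ring
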